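/- Let y, y′, c : [0,∞) → [0,∞) be locally piecewise constant with y(t) ≤ y′(t) for all t ≥ 0. Let x be a queue trajectory for (y, c) and x′ a queue trajectory for (y′, c) with x(0) ≤ x′(0). Then x(t) ≤ x′(t) for all t ≥ 0, and the corresponding outflows satisfy z(t) ≤ z′(t) for all t ≥ 0. -/

import Mathlib

open MeasureTheory

/-- `f` is piecewise constant on the set `s`: there is a finite set `D` of breakpoints
such that `f` is constant between consecutive breakpoints (pieces are right-open). -/
def PwcOn (f : ℝ → ℝ) (s : Set ℝ) : Prop :=
  ∃ D : Finset ℝ, ∀ u ∈ s, ∀ v ∈ s, u ≤ v → (∀ d ∈ D, d ∉ Set.Ioc u v) → f u = f v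

/-- `f` is locally piecewise constant on `[0, ∞)`: piecewise constant on every compact
subinterval. -/
def LocPwc (f : ℝ → ℝ) : Prop :=
  ∀ a b : ℝ, PwcOn f (Set.Ici 0 ∩ Set.Icc a b)

/-- The net rate of change of the queue: `y − c` when the queue is positive, and
`max (y − c) 0` when the queue is empty. -/
noncomputable def qrate (y c x : ℝ → ℝ) (r : ℝ) : ℝ :=
  if 0 < x r then y r - c r else max (y r - c r) 0

/-- `x` is a queue trajectory for inflow `y` and capacity `c`: it is nonnegative on
`[0, ∞)` and satisfies `x t = x 0 + ∫_0^t qrate` for every `t ≥ 0`. -/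
def QueueTraj (y c x : ℝ → ℝ) : Prop :=
  (∀ t, 0 ≤ t → 0 ≤ x t) ∧
  ∀ t, 0 ≤ t → x t = x 0 + ∫ r in (0:ℝ)..t, qrate y c x r

/-- The outflow of the queue trajectory `x` for `(y, c)`: the capacity when the queue is
positive, and `min y c` when the queue is empty. -/
noncomputable def outflow (y c x : ℝ → ℝ) (t : ℝ) : ℝ :=
  if 0 < x t then c t else min (y t) (c t)

/-- `α` is a transition point of the queue trajectory `x`: `x α = 0` and `x` is strictly
positive on some interval `(α, α + ε]`. -/
def TransitionPt (x : ℝ → ℝ) (α : ℝ) : Prop :=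
  0 ≤ α ∧ x α = 0 ∧ ∃ ε > 0, ∀ t ∈ Set.Ioc α (α + ε), 0 < x t

/-- A piecewise constant function is integrable on a bounded interval. -/
theorem LocPwc.integrableOn_Icc {f : ℝ → ℝ} (hf : LocPwc f) (b : ℝ) :
    IntegrableOn f (Set.Icc 0 b) := by
  classical
  obtain ⟨D, hD⟩ := hf 0 b
  let k : ℝ → Finset ℝ := fun u => D.filter (· ≤ u)
  have hk : Monotone k := fun u v huv d hd => by
    simp only [k, Finset.mem_filter] at hd ⊢
    exact ⟨hd.1, hd.2.trans huv⟩
  have hcov : Set.Icc 0 b ⊆ ⋃ A ∈ D.powerset, (Set.Icc 0 b ∩ k ⁻¹' {A}) := fun u hu => by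
    simp only [Set.mem_iUnion]
    exact ⟨k u, by simp [k], hu, rfl⟩
  refine IntegrableOn.mono_set ?_ hcov
  rw [integrableOn_finset_iUnion]
  intro A _
  have hmeas : MeasurableSet (Set.Icc 0 b ∩ k ⁻¹' {A}) :=
    measurableSet_Icc.inter (Set.ordConnected_singleton.preimage_mono hk).measurableSet
  have hfin : volume (Set.Icc 0 b ∩ k ⁻¹' {A}) ≠ ⊤ :=
    ((measure_mono Set.inter_subset_left).trans_lt measure_Icc_lt_top).ne
  have hconst : ∀ u ∈ Set.Icc 0 b, ∀ v ∈ Set.Icc 0 b, u ≤ v → k u = k v → f u = f v := by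
    intro u hu v hv huv hkuv
    refine hD u ⟨hu.1, hu⟩ v ⟨hv.1, hv⟩ huv fun d hd hduv => ?_
    have : d ∈ k u := by
      rw [hkuv]
      exact Finset.mem_filter.2 ⟨hd, hduv.2⟩
    exact absurd (Finset.mem_filter.1 this).2 (not_le.2 hduv.1)
  rcases (Set.Icc 0 b ∩ k ⁻¹' {A}).eq_empty_or_nonempty with h | ⟨u, hu, huA⟩
  · rw [h]
    exact integrableOn_empty
  · refine (integrableOn_const (C := f u) hfin).congr_fun (fun v hv => ?_) hmeas
    have hkuv : k u = k v := Eq.trans huA (Eq.symm hv.2)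
    rcases le_total u v with h | h
    · exact hconst u hu v hv.1 h hkuv
    · exact (hconst v hv.1 u hu h hkuv.symm).symm

/-- If `x` agrees on `[0, ∞)` with a constant plus the (possibly junk-valued) integral of `q`,
then its positivity set is measurable. -/
theorem measurableSet_pos_of_eq_add_integral {x q : ℝ → ℝ}
    (hx : ∀ t, 0 ≤ t → x t = x 0 + ∫ r in (0 : ℝ)..t, q r) :
    MeasurableSet (Set.Ici 0 ∩ {t | 0 < x t}) := by
  set S : Set ℝ := {t | 0 ≤ t ∧ IntervalIntegrable q volume 0 t} with hS
  have hdown : ∀ s ∈ S, ∀ t, 0 ≤ t → t ≤ s → t ∈ S := fun s hs t ht hts =>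
    ⟨ht, hs.2.mono_set (by
      rw [Set.uIcc_of_le ht, Set.uIcc_of_le hs.1]
      exact Set.Icc_subset_Icc_right hts)⟩
  have hSm : MeasurableSet S :=
    Set.OrdConnected.measurableSet ⟨fun a ha b hb c hc => hdown b hb c (ha.1.trans hc.1) hc.2⟩
  have hcontIcc : ∀ s ∈ S, ContinuousOn x (Set.Icc 0 s) := fun s hs => by
    have h := intervalIntegral.continuousOn_primitive_interval' hs.2 Set.left_mem_uIcc
    rw [Set.uIcc_of_le hs.1] at h
    exact (continuousOn_const.add h).congr fun t ht => hx t ht.1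
  have hcont : ContinuousOn x S := by
    intro s hs
    by_cases h : ∃ r ∈ S, s < r
    · obtain ⟨r, hr, hsr⟩ := h
      refine (hcontIcc r hr s ⟨hs.1, hsr.le⟩).mono_of_mem_nhdsWithin ?_
      filter_upwards [self_mem_nhdsWithin, mem_nhdsWithin_of_mem_nhds (Iio_mem_nhds hsr)]
        with u hu hur
      exact ⟨hu.1, le_of_lt hur⟩
    · push Not at h
      exact (hcontIcc s hs s ⟨hs.1, le_rfl⟩).mono fun u hu => ⟨hu.1, h u hu⟩
  have hoff : ∀ t, 0 ≤ t → t ∉ S → x t = x 0 := fun t ht htS => by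
    rw [hx t ht, intervalIntegral.integral_undef fun h => htS ⟨ht, h⟩, add_zero]
  obtain ⟨U, hU, hUS⟩ := continuousOn_iff'.1 hcont (Set.Ioi 0) isOpen_Ioi
  have heq : Set.Ici 0 ∩ {t | 0 < x t} = U ∩ S ∪ (Set.Ici 0 \ S) ∩ {_t | 0 < x 0} := by
    rw [← hUS]
    ext t
    by_cases htS : t ∈ S
    · simp [htS, htS.1]
    · simp only [Set.mem_inter_iff, Set.mem_union, Set.mem_sdiff, Set.mem_Ici, Set.mem_ofPred_eq,
        htS, not_false_eq_true, and_true, and_false, false_or]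
      exact and_congr_right fun ht => by rw [hoff t ht htS]
  rw [heq]
  exact (hU.measurableSet.inter hSm).union
    ((measurableSet_Ici.diff hSm).inter (MeasurableSet.const _))

/-- The net rate of a queue trajectory with locally piecewise constant data is integrable on
every interval `[0, b]`. -/
theorem QueueTraj.integrableOn_qrate {y c x : ℝ → ℝ} (hx : QueueTraj y c x) (hy : LocPwc y)
    (hc : LocPwc c) (b : ℝ) : IntegrableOn (qrate y c x) (Set.Icc 0 b) := by
  have hP := measurableSet_pos_of_eq_add_integral hx.2
  have hyc : IntegrableOn (fun r => y r - c r) (Set.Icc 0 b) :=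
    (hy.integrableOn_Icc b).sub (hc.integrableOn_Icc b)
  have hmax : IntegrableOn (fun r => max (y r - c r) 0) (Set.Icc 0 b) := hyc.pos_part
  rw [← Set.inter_union_sdiff (Set.Icc 0 b) (Set.Ici 0 ∩ {t | 0 < x t})]
  refine IntegrableOn.union ?_ ?_
  · refine (hyc.mono_set Set.inter_subset_left).congr_fun (fun r hr => ?_)
      (measurableSet_Icc.inter hP)
    exact (if_pos hr.2.2).symm
  · refine (hmax.mono_set Set.sdiff_subset).congr_fun (fun r hr => ?_) (measurableSet_Icc.diff hP)
    exact (if_neg fun h => hr.2 ⟨hr.1.1, h⟩).symm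

theorem QueueTraj.intervalIntegrable_qrate {y c x : ℝ → ℝ} (hx : QueueTraj y c x)
    (hy : LocPwc y) (hc : LocPwc c) {a b : ℝ} (ha : 0 ≤ a) (hab : a ≤ b) :
    IntervalIntegrable (qrate y c x) volume a b := by
  rw [intervalIntegrable_iff_integrableOn_Icc_of_le hab]
  exact (hx.integrableOn_qrate hy hc b).mono_set (Set.Icc_subset_Icc_left ha)

theorem QueueTraj.continuousOn_Icc {y c x : ℝ → ℝ} (hx : QueueTraj y c x) (hy : LocPwc y)
    (hc : LocPwc c) {b : ℝ} (hb : 0 ≤ b) : ContinuousOn x (Set.Icc 0 b) := by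
  have h := intervalIntegral.continuousOn_primitive_interval'
    (hx.intervalIntegrable_qrate hy hc le_rfl hb) Set.left_mem_uIcc
  rw [Set.uIcc_of_le hb] at h
  exact (continuousOn_const.add h).congr fun t ht => hx.2 t ht.1

theorem QueueTraj.sub_eq_integral {y c x : ℝ → ℝ} (hx : QueueTraj y c x) (hy : LocPwc y)
    (hc : LocPwc c) {a b : ℝ} (ha : 0 ≤ a) (hab : a ≤ b) :
    x b - x a = ∫ r in a..b, qrate y c x r := by
  rw [hx.2 b (ha.trans hab), hx.2 a ha, ← intervalIntegral.integral_interval_sub_left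
    (hx.intervalIntegrable_qrate hy hc le_rfl (ha.trans hab))
    (hx.intervalIntegrable_qrate hy hc le_rfl ha)]
  ring

theorem sub_le_qrate (y c x : ℝ → ℝ) (r : ℝ) : y r - c r ≤ qrate y c x r := by
  unfold qrate
  split_ifs
  exacts [le_rfl, le_max_left _ _]

/-- Queue lengths are monotone in the inflow and the initial queue. -/
theorem QueueTraj.mono {y y' c x x' : ℝ → ℝ} (hy : LocPwc y) (hy' : LocPwc y') (hc : LocPwc c)
    (hle : ∀ t, 0 ≤ t → y t ≤ y' t) (hx : QueueTraj y c x) (hx' : QueueTraj y' c x')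
    (h0 : x 0 ≤ x' 0) {t : ℝ} (ht : 0 ≤ t) : x t ≤ x' t := by
  have hclosed : IsClosed {r ∈ Set.Icc 0 t | x r ≤ x' r} :=
    isClosed_Icc.isClosed_le (hx.continuousOn_Icc hy hc ht) (hx'.continuousOn_Icc hy' hc ht)
  obtain ⟨s, ⟨hs, hsx⟩, hmax⟩ :=
    (isCompact_Icc.of_isClosed_subset hclosed (Set.sep_subset _ _)).exists_isGreatest
      ⟨0, ⟨le_rfl, ht⟩, h0⟩
  have hpos : ∀ r ∈ Set.Ioo s t, 0 < x r := fun r hr => by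
    have hr0 : 0 ≤ r := hs.1.trans hr.1.le
    by_contra hxr
    exact not_lt.2 (hmax ⟨⟨hr0, hr.2.le⟩, (not_lt.1 hxr).trans (hx'.1 r hr0)⟩) hr.1
  have hint : ∫ r in s..t, qrate y c x r ≤ ∫ r in s..t, qrate y' c x' r := by
    refine intervalIntegral.integral_mono_on_of_le_Ioo hs.2
      (hx.intervalIntegrable_qrate hy hc hs.1 hs.2)
      (hx'.intervalIntegrable_qrate hy' hc hs.1 hs.2) fun r hr => ?_
    calc qrate y c x r = y r - c r := if_pos (hpos r hr)
      _ ≤ y' r - c r := sub_le_sub_right (hle r (hs.1.trans hr.1.le)) _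
      _ ≤ qrate y' c x' r := sub_le_qrate y' c x' r
  rw [← hx.sub_eq_integral hy hc hs.1 hs.2, ← hx'.sub_eq_integral hy' hc hs.1 hs.2] at hint
  linarith

/-- Monotonicity of the single-link queue: if `y ≤ y′` pointwise and `x 0 ≤ x′ 0`, then
the queue lengths and outflows remain ordered for all `t ≥ 0`. -/
theorem queue_monotone (y y' c x x' : ℝ → ℝ)
    (hy_nn : ∀ t, 0 ≤ t → 0 ≤ y t) (hy'_nn : ∀ t, 0 ≤ t → 0 ≤ y' t)
    (hc_nn : ∀ t, 0 ≤ t → 0 ≤ c t)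
    (hy_pwc : LocPwc y) (hy'_pwc : LocPwc y') (hc_pwc : LocPwc c)
    (hle : ∀ t, 0 ≤ t → y t ≤ y' t)
    (hx : QueueTraj y c x) (hx' : QueueTraj y' c x')
    (h0 : x 0 ≤ x' 0) :
    ∀ t, 0 ≤ t → x t ≤ x' t ∧ outflow y c x t ≤ outflow y' c x' t := by
  intro t ht
  have hxt : x t ≤ x' t := hx.mono hy_pwc hy'_pwc hc_pwc hle hx' h0 ht
  refine ⟨hxt, ?_⟩
  unfold outflow
  split_ifs with h h'
  · exact le_rfl
  · exact absurd (h.trans_le hxt) h'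
  · exact min_le_right _ _
  · exact min_le_min_right _ (hle t ht)
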